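/- arXiv:2511.05950 — 3 statements merged into one kernel-verified Lean document; each statement's English description precedes it below -/
import Mathlib

section
/- Let D ≥ 4 be an integer and let T, c be real numbers with T > 0. Define f : ℝ → ℝ by f(λ) = λ^{D−3}·T + λ^{D−1}·c. If the derivative of f at λ = 1 vanishes, then Derrick's relation (D−3)·T + (D−1)·c = 0 holds, c = −((D−3)/(D−1))·T < 0, and the second derivative of f at λ = 1 equals −2·(D−3)·T, which is strictly negative. -/
theorem deriv_pow_mul_add_pow_mul (m n : ℕ) (a b : ℝ) :
    deriv (fun l : ℝ => l ^ m * a + l ^ n * b) =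
      fun l => l ^ (m - 1) * (m * a) + l ^ (n - 1) * (n * b) := by
  ext l
  have h := ((hasDerivAt_pow m l).mul_const a).add ((hasDerivAt_pow n l).mul_const b)
  exact h.deriv.trans (by ring)

/-- Derrick's relation at finite temperature: if `f λ = λ^{D-3} T + λ^{D-1} c` with `T > 0`
is stationary at `λ = 1`, then `(D-3)T + (D-1)c = 0`, `c = -((D-3)/(D-1)) T < 0`, and the
second derivative of `f` at `1` equals `-2(D-3)T < 0`. -/
theorem stmt1 (D : ℕ) (hD : 4 ≤ D) (T c : ℝ) (hT : 0 < T)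
    (f : ℝ → ℝ) (hf : ∀ l : ℝ, f l = l ^ (D - 3) * T + l ^ (D - 1) * c)
    (hcrit : deriv f 1 = 0) :
    ((D : ℝ) - 3) * T + ((D : ℝ) - 1) * c = 0 ∧
    c = -(((D : ℝ) - 3) / ((D : ℝ) - 1)) * T ∧
    c < 0 ∧
    deriv (deriv f) 1 = -2 * ((D : ℝ) - 3) * T ∧
    deriv (deriv f) 1 < 0 := by
  obtain ⟨k, rfl⟩ := Nat.exists_eq_add_of_le' hD
  obtain rfl : f = fun l => l ^ (k + 4 - 3) * T + l ^ (k + 4 - 1) * c := funext hf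
  have hk : (0 : ℝ) ≤ k := k.cast_nonneg
  simp only [deriv_pow_mul_add_pow_mul, one_pow, one_mul, Nat.add_sub_cancel,
    show k + 4 - 3 = k + 1 by lia, show k + 4 - 1 = k + 3 by lia,
    show k + 3 - 1 = k + 2 by lia] at hcrit ⊢
  push_cast at hcrit ⊢
  have hT' : 0 < ((k : ℝ) + 1) * T := by positivity
  have hsecond : (k : ℝ) * ((k + 1) * T) + (k + 2) * ((k + 3) * c) = -2 * (k + 4 - 3) * T := by
    linear_combination ((k : ℝ) + 2) * hcrit
  refine ⟨by linear_combination hcrit, ?_, ?_, hsecond, by linarith⟩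
  · have hne : (k : ℝ) + 4 - 1 ≠ 0 := by linarith
    field_simp
    linear_combination hcrit
  · exact neg_of_mul_neg_right (a := (k : ℝ) + 3) (by linarith) (by positivity)
end

section
/- Let D ≥ 4 be an integer, n = D−1, and β > 0. Let φ : ℝⁿ × ℝ → ℝ be continuously differentiable, nonnegative, β-periodic in time, vanishing at spatial infinity, and spatially radial and nonincreasing. Assume the gradient term T[φ] = (1/2)·∫_{τ∈[0,β)}∫_{ℝⁿ} ‖∇ₓφ(x,τ)‖² dx dτ and the kinetic term K[φ] = (1/2)·∫_{τ∈[0,β)}∫_{ℝⁿ} (∂_τφ(x,τ))² dx dτ are both finite. Then for every R > 0 there exists a constant c ≥ 0 such that ‖x‖^{(D−3)/2}·φ(x,τ) ≤ c for all τ and all x with ‖x‖ ≥ R. -/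
open MeasureTheory

/-- The spatial gradient `∇ₓφ(x,τ)` of `φ : ℝⁿ × ℝ → ℝ`. -/
noncomputable def spatialGrad {n : ℕ} (φ : EuclideanSpace ℝ (Fin n) × ℝ → ℝ)
    (x : EuclideanSpace ℝ (Fin n)) (τ : ℝ) : EuclideanSpace ℝ (Fin n) :=
  gradient (fun y => φ (y, τ)) x

/-- The time derivative `∂_τφ(x,τ)` of `φ : ℝⁿ × ℝ → ℝ`. -/
noncomputable def timeDeriv {n : ℕ} (φ : EuclideanSpace ℝ (Fin n) × ℝ → ℝ)
    (x : EuclideanSpace ℝ (Fin n)) (τ : ℝ) : ℝ :=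
  deriv (fun s => φ (x, s)) τ

/-- `φ` vanishes at spatial infinity: for every `ε > 0` there is a compact `K ⊆ ℝⁿ` with
`|φ(x,τ)| < ε` for all `x ∉ K` and all `τ`. -/
def VanishesAtSpatialInfinity {n : ℕ} (φ : EuclideanSpace ℝ (Fin n) × ℝ → ℝ) : Prop :=
  ∀ ε > (0 : ℝ), ∃ K : Set (EuclideanSpace ℝ (Fin n)), IsCompact K ∧
    ∀ x ∉ K, ∀ τ : ℝ, |φ (x, τ)| < ε

/-- `φ` is spatially radial and nonincreasing, with radial profile `g`. -/
def SpatiallyRadialNonincreasing {n : ℕ} (φ : EuclideanSpace ℝ (Fin n) × ℝ → ℝ)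
    (g : ℝ → ℝ → ℝ) : Prop :=
  (∀ x : EuclideanSpace ℝ (Fin n), ∀ τ : ℝ, φ (x, τ) = g ‖x‖ τ) ∧
  ∀ τ : ℝ, AntitoneOn (fun r => g r τ) (Set.Ici (0 : ℝ))

/-- A continuous function on `[a, b]` attains some value not exceeding its average. -/
lemma exists_le_of_intervalIntegral_le {f : ℝ → ℝ} (hf : Continuous f) {a b C : ℝ} (hab : a < b)
    (h : ∫ x in a..b, f x ≤ C * (b - a)) : ∃ x ∈ Set.Icc a b, f x ≤ C := by
  by_contra! hlt
  have key := intervalIntegral.integral_lt_integral_of_continuousOn_of_le_of_exists_lt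
    (f := fun _ => C) (g := f) hab continuousOn_const hf.continuousOn
    (fun x hx => (hlt x ⟨hx.1.le, hx.2⟩).le)
    ⟨a, ⟨le_rfl, hab.le⟩, hlt a ⟨le_rfl, hab.le⟩⟩
  rw [intervalIntegral.integral_const, smul_eq_mul] at key
  linarith

/-- Fubini for iterated interval integrals of a continuous function. -/
lemma intervalIntegral_swap_of_continuous {f : ℝ → ℝ → ℝ} (hf : Continuous f.uncurry)
    {a b c d : ℝ} (hab : a ≤ b) (hcd : c ≤ d) :
    ∫ x in a..b, ∫ y in c..d, f x y = ∫ y in c..d, ∫ x in a..b, f x y := by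
  simp only [intervalIntegral.integral_of_le hab, intervalIntegral.integral_of_le hcd]
  apply integral_integral_swap
  rw [Measure.prod_restrict, ← Measure.volume_eq_prod]
  exact (hf.continuousOn.integrableOn_compact (isCompact_Icc.prod isCompact_Icc)).mono_set
    (Set.prod_mono Set.Ioc_subset_Icc_self Set.Ioc_subset_Icc_self)

lemma intervalIntegral_le_setIntegral_Ioi {f : ℝ → ℝ} (hf : IntegrableOn f (Set.Ioi 0))
    (h0 : ∀ x ∈ Set.Ioi (0 : ℝ), 0 ≤ f x) {a b : ℝ} (ha : 0 < a) (hab : a ≤ b) :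
    ∫ x in a..b, f x ≤ ∫ x in Set.Ioi 0, f x := by
  rw [intervalIntegral.integral_of_le hab]
  exact setIntegral_mono_set hf ((ae_restrict_iff' measurableSet_Ioi).2 (.of_forall h0))
    (LE.le.eventuallyLE fun x hx => ha.trans hx.1)

lemma intervalIntegral_inv_pow_le {k : ℕ} (hk : 1 ≤ k) {a b : ℝ} (ha : 0 < a) (hab : a ≤ b) :
    ∫ x in a..b, (x ^ (k + 1))⁻¹ ≤ (a ^ k)⁻¹ := by
  have hb : 0 < b := ha.trans_le hab
  have hk' : (1 : ℝ) ≤ k := by exact_mod_cast hk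
  have h0 : (0 : ℝ) ∉ Set.uIcc a b := by
    rw [Set.uIcc_of_le hab]
    exact fun h => ha.not_ge h.1
  have e : ∀ x : ℝ, (x ^ (k + 1))⁻¹ = x ^ (-((k : ℤ) + 1)) := fun x => by
    rw [zpow_neg]
    norm_cast
  simp only [e]
  rw [integral_zpow (Or.inr ⟨by omega, h0⟩), show -((k : ℤ) + 1) + 1 = -(k : ℤ) by ring,
    zpow_neg, zpow_neg, zpow_natCast, zpow_natCast]
  push_cast
  have h1 : 0 < (a ^ k)⁻¹ := by positivity
  have h2 : 0 < (b ^ k)⁻¹ := by positivity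
  rw [show (-((k : ℝ) + 1) + 1) = -(k : ℝ) by ring, div_neg, ← neg_div, div_le_iff₀ (by linarith)]
  nlinarith

lemma abs_le_half_mul_sq_add (x : ℝ) {c : ℝ} (hc : 0 < c) : |x| ≤ (c * x ^ 2 + c⁻¹) / 2 := by
  have h : c * x ^ 2 + c⁻¹ - 2 * |x| = c⁻¹ * (c * |x| - 1) ^ 2 := by
    rw [← sq_abs x]
    field_simp
    ring
  have : 0 ≤ c⁻¹ * (c * |x| - 1) ^ 2 := by positivity
  linarith

section Profile

variable {G P Q : ℝ → ℝ → ℝ} {β : ℝ} {k : ℕ}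

/-- At every radius `s > 0`, some time slice satisfies the radial decay estimate provided by the
gradient term. -/
lemma exists_time_profile_le (hβ : 0 < β) (hk : 1 ≤ k) (hP : Continuous P.uncurry)
    (hGP : ∀ r τ, HasDerivAt (fun r => G r τ) (P r τ) r)
    (hvan : ∀ ε > 0, ∃ L, ∀ r ≥ L, ∀ τ, G r τ < ε)
    (hint : IntegrableOn (fun r => r ^ (k + 1) * ∫ τ in 0..β, P r τ ^ 2) (Set.Ioi 0))
    {s : ℝ} (hs : 0 < s) :
    ∃ σ ∈ Set.Icc 0 β, G s σ ≤
      (1 + ((∫ r in Set.Ioi 0, r ^ (k + 1) * ∫ τ in 0..β, P r τ ^ 2) / β + 1) / 2) *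
        (s ^ ((k : ℝ) / 2))⁻¹ := by
  set A := ∫ r in Set.Ioi 0, r ^ (k + 1) * ∫ τ in 0..β, P r τ ^ 2 with hA
  set q := s ^ ((k : ℝ) / 2) with hq
  have hq0 : 0 < q := Real.rpow_pos_of_pos hs _
  have hq2 : s ^ k = q * q := by
    rw [hq, ← Real.rpow_add hs, add_halves, Real.rpow_natCast]
  obtain ⟨L₀, hL₀⟩ := hvan q⁻¹ (by positivity)
  set L := max L₀ s
  have hsL : s ≤ L := le_max_right _ _
  have hcont : Continuous (Function.uncurry fun τ r => r ^ (k + 1) * P r τ ^ 2) := by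
    have : Continuous fun z : ℝ × ℝ => P z.2 z.1 := hP.comp continuous_swap
    simp only [Function.uncurry_def]
    fun_prop
  have hE : ∫ τ in 0..β, ∫ r in s..L, r ^ (k + 1) * P r τ ^ 2 ≤ A / β * (β - 0) := by
    rw [intervalIntegral_swap_of_continuous hcont hβ.le hsL, sub_zero, div_mul_cancel₀ _ hβ.ne']
    simp only [intervalIntegral.integral_const_mul]
    exact intervalIntegral_le_setIntegral_Ioi hint (fun r hr => mul_nonneg (pow_nonneg hr.le _)
      (intervalIntegral.integral_nonneg hβ.le fun _ _ => sq_nonneg _)) hs hsL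
  obtain ⟨σ, hσ, hEσ⟩ := exists_le_of_intervalIntegral_le
    (intervalIntegral.continuous_parametric_intervalIntegral_of_continuous' hcont s L) hβ hE
  refine ⟨σ, hσ, ?_⟩
  have hPσ : Continuous fun r => P r σ := hP.comp (by fun_prop : Continuous fun r => (r, σ))
  have hftc : ∫ r in s..L, P r σ = G L σ - G s σ :=
    intervalIntegral.integral_eq_sub_of_hasDerivAt (fun r _ => hGP r σ)
      (hPσ.intervalIntegrable _ _)
  have hinv : ContinuousOn (fun r : ℝ => (r ^ (k + 1))⁻¹) (Set.uIcc s L) := by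
    rw [Set.uIcc_of_le hsL]
    exact (continuous_pow _).continuousOn.inv₀ fun r hr => (pow_pos (hs.trans_le hr.1) _).ne'
  have hi1 : IntervalIntegrable (fun r => q⁻¹ / 2 * (r ^ (k + 1) * P r σ ^ 2)) volume s L :=
    Continuous.intervalIntegrable (by fun_prop) _ _
  have hi2 : IntervalIntegrable (fun r : ℝ => q / 2 * (r ^ (k + 1))⁻¹) volume s L :=
    hinv.intervalIntegrable.const_mul _
  have hmono : ∫ r in s..L, -P r σ ≤
      ∫ r in s..L, (q⁻¹ / 2 * (r ^ (k + 1) * P r σ ^ 2) + q / 2 * (r ^ (k + 1))⁻¹) := by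
    refine intervalIntegral.integral_mono_on hsL (hPσ.neg.intervalIntegrable _ _) (hi1.add hi2)
      fun r hr => ?_
    have hr0 : 0 < r ^ (k + 1) := pow_pos (hs.trans_le hr.1) _
    have := abs_le_half_mul_sq_add (P r σ) (c := q⁻¹ * r ^ (k + 1)) (by positivity)
    rw [mul_inv, inv_inv] at this
    linarith [neg_abs_le (P r σ)]
  rw [intervalIntegral.integral_add hi1 hi2, intervalIntegral.integral_neg,
    intervalIntegral.integral_const_mul, intervalIntegral.integral_const_mul, hftc] at hmono
  have h1 := mul_le_mul_of_nonneg_left hEσ (by positivity : 0 ≤ q⁻¹ / 2)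
  have h2 := mul_le_mul_of_nonneg_left (intervalIntegral_inv_pow_le hk hs hsL)
    (by positivity : 0 ≤ q / 2)
  have h3 : q / 2 * (s ^ k)⁻¹ = q⁻¹ / 2 := by
    rw [hq2]
    field_simp
  have h4 := hL₀ L (le_max_left _ _) σ
  rw [h3] at h2
  linarith

/-- Oscillation in time at fixed radius is controlled by the kinetic density. -/
lemma profile_sub_le (hβ : 0 < β) {q : ℝ → ℝ} {f : ℝ → ℝ} (hq : Continuous q)
    (hf : ∀ τ, HasDerivAt f (q τ) τ) {c : ℝ} (hc : 0 < c)
    {σ τ : ℝ} (hσ : σ ∈ Set.Icc 0 β) (hτ : τ ∈ Set.Icc 0 β) :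
    f τ - f σ ≤ (c * (∫ t in 0..β, q t ^ 2) + c⁻¹ * β) / 2 := by
  have hftc : ∫ t in σ..τ, q t = f τ - f σ :=
    intervalIntegral.integral_eq_sub_of_hasDerivAt (fun r _ => hf r) (hq.intervalIntegrable _ _)
  have h1 : |∫ t in σ..τ, q t| ≤ ∫ t in 0..β, |q t| := by
    rw [← Real.norm_eq_abs]
    refine intervalIntegral.norm_integral_le_integral_norm_uIoc.trans ?_
    rw [intervalIntegral.integral_of_le hβ.le]
    refine setIntegral_mono_set hq.abs.integrableOn_Ioc (.of_forall fun _ => abs_nonneg _)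
      (LE.le.eventuallyLE fun t ht => ?_)
    rw [Set.uIoc, Set.mem_Ioc] at ht
    exact ⟨(le_min hσ.1 hτ.1).trans_lt ht.1, ht.2.trans (max_le hσ.2 hτ.2)⟩
  have h2 : ∫ t in 0..β, |q t| ≤ ∫ t in 0..β, (c / 2 * q t ^ 2 + c⁻¹ / 2) := by
    refine intervalIntegral.integral_mono_on hβ.le (hq.abs.intervalIntegrable _ _)
      (Continuous.intervalIntegrable (by fun_prop) _ _) fun t _ => ?_
    linarith [abs_le_half_mul_sq_add (q t) hc]
  rw [intervalIntegral.integral_add (Continuous.intervalIntegrable (by fun_prop) _ _)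
    (Continuous.intervalIntegrable (by fun_prop) _ _), intervalIntegral.integral_const_mul,
    intervalIntegral.integral_const, smul_eq_mul] at h2
  linarith [le_abs_self (∫ t in σ..τ, q t)]

/-- Decay of a radial profile with finite weighted gradient and kinetic integrals. -/
lemma profile_decay (hβ : 0 < β) (hk : 1 ≤ k) (hP : Continuous P.uncurry)
    (hQ : Continuous Q.uncurry)
    (hGP : ∀ r τ, HasDerivAt (fun r => G r τ) (P r τ) r)
    (hGQ : ∀ r τ, HasDerivAt (fun τ => G r τ) (Q r τ) τ)
    (hanti : ∀ τ, AntitoneOn (fun r => G r τ) (Set.Ici 0))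
    (hper : ∀ r τ, G r (τ + β) = G r τ)
    (hvan : ∀ ε > 0, ∃ L, ∀ r ≥ L, ∀ τ, G r τ < ε)
    (hPint : IntegrableOn (fun r => r ^ (k + 1) * ∫ τ in 0..β, P r τ ^ 2) (Set.Ioi 0))
    (hQint : IntegrableOn (fun r => r ^ (k + 1) * ∫ τ in 0..β, Q r τ ^ 2) (Set.Ioi 0))
    {R : ℝ} (hR : 0 < R) :
    ∃ c, 0 ≤ c ∧ ∀ τ, ∀ r ≥ R, r ^ ((k : ℝ) / 2) * G r τ ≤ c := by
  set A := ∫ r in Set.Ioi 0, r ^ (k + 1) * ∫ τ in 0..β, P r τ ^ 2 with hA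
  set B := ∫ r in Set.Ioi 0, r ^ (k + 1) * ∫ τ in 0..β, Q r τ ^ 2 with hB
  have hA0 : 0 ≤ A := setIntegral_nonneg measurableSet_Ioi fun r hr =>
    mul_nonneg (pow_nonneg (le_of_lt hr) _)
      (intervalIntegral.integral_nonneg hβ.le fun _ _ => sq_nonneg _)
  have hB0 : 0 ≤ B := setIntegral_nonneg measurableSet_Ioi fun r hr =>
    mul_nonneg (pow_nonneg (le_of_lt hr) _)
      (intervalIntegral.integral_nonneg hβ.le fun _ _ => sq_nonneg _)
  set C := (1 + (A / β + 1) / 2) + (4 * B / R ^ 2 + β / 2) with hC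
  have hC0 : 0 ≤ C := by positivity
  refine ⟨2 ^ ((k : ℝ) / 2) * C, by positivity, fun τ r hr => ?_⟩
  have hr0 : 0 < r := hR.trans_le hr
  obtain ⟨t, ht, hGt⟩ := (show Function.Periodic (G r) β from hper r).exists_mem_Ico₀ hβ τ
  rw [hGt]
  have hcont : Continuous fun r => r ^ (k + 1) * ∫ τ in 0..β, Q r τ ^ 2 := by
    have h : Continuous (Function.uncurry fun r τ => Q r τ ^ 2) := hQ.pow 2
    exact (continuous_pow _).mul
      (intervalIntegral.continuous_parametric_intervalIntegral_of_continuous' h 0 β)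
  obtain ⟨s, ⟨hs1, hs2⟩, hsB⟩ := exists_le_of_intervalIntegral_le hcont (half_lt_self hr0)
    (C := 2 * B / r) (by
      rw [show 2 * B / r * (r - r / 2) = B by field_simp; ring]
      exact intervalIntegral_le_setIntegral_Ioi hQint (fun r hr => mul_nonneg (pow_nonneg
        (le_of_lt hr) _) (intervalIntegral.integral_nonneg hβ.le fun _ _ => sq_nonneg _))
        (half_pos hr0) (half_le_self hr0.le))
  have hs0 : 0 < s := (half_pos hr0).trans_le hs1
  obtain ⟨σ, hσ, hGσ⟩ := exists_time_profile_le hβ hk hP hGP hvan hPint hs0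
  rw [← hA] at hGσ
  set q := s ^ ((k : ℝ) / 2) with hq
  have hq0 : 0 < q := Real.rpow_pos_of_pos hs0 _
  have hq2 : s ^ k = q * q := by
    rw [hq, ← Real.rpow_add hs0, add_halves, Real.rpow_natCast]
  have hosc := profile_sub_le hβ (hQ.comp (by fun_prop : Continuous fun τ => (s, τ)))
    (hGQ s) hq0 hσ ⟨ht.1, ht.2.le⟩
  simp only [Function.comp_def, Function.uncurry_apply_pair] at hosc
  set a := ∫ τ in 0..β, Q s τ ^ 2 with ha
  have hqa : q * a ≤ 2 * (4 * B / R ^ 2) * q⁻¹ := by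
    have h1 : s ^ (k + 1) * a ≤ 2 * B / s :=
      hsB.trans (div_le_div_of_nonneg_left (by positivity) hs0 hs2)
    have h2 : q * a = q⁻¹ * s⁻¹ * (s ^ (k + 1) * a) := by
      rw [pow_succ, hq2]
      field_simp
    have h3 : (R / 2) ^ 2 ≤ s ^ 2 := by
      apply pow_le_pow_left₀ (by positivity)
      linarith
    calc q * a ≤ q⁻¹ * s⁻¹ * (2 * B / s) := h2 ▸ mul_le_mul_of_nonneg_left h1 (by positivity)
      _ = 2 * B / s ^ 2 * q⁻¹ := by field_simp
      _ ≤ 2 * B / (R / 2) ^ 2 * q⁻¹ := by gcongr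
      _ = _ := by field_simp; ring
  have hGs : G s t ≤ C * q⁻¹ := by
    rw [hC]
    linarith
  have hGr : G r t ≤ C * q⁻¹ := (hanti t hs0.le hr0.le hs2).trans hGs
  have hrq : r ^ ((k : ℝ) / 2) ≤ 2 ^ ((k : ℝ) / 2) * q := by
    rw [hq, ← Real.mul_rpow (by norm_num) hs0.le]
    exact Real.rpow_le_rpow hr0.le (by linarith) (by positivity)
  calc r ^ ((k : ℝ) / 2) * G r t ≤ r ^ ((k : ℝ) / 2) * (C * q⁻¹) := by gcongr
    _ ≤ 2 ^ ((k : ℝ) / 2) * q * (C * q⁻¹) := by gcongr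
    _ = 2 ^ ((k : ℝ) / 2) * C := by field_simp

end Profile

/-- Integrating out time and passing to polar coordinates. -/
lemma integrableOn_pow_mul_of_norm {n k : ℕ} (hn : n = k + 2) {β : ℝ} (hβ : 0 < β)
    {f : ℝ → ℝ → ℝ}
    (h : IntegrableOn (fun z : EuclideanSpace ℝ (Fin n) × ℝ => f ‖z.1‖ z.2)
      (Set.univ ×ˢ Set.Ico (0 : ℝ) β) volume) :
    IntegrableOn (fun r => r ^ (k + 1) * ∫ τ in 0..β, f r τ) (Set.Ioi 0) := by
  rw [IntegrableOn, Measure.volume_eq_prod, ← Measure.prod_restrict, Measure.restrict_univ] at h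
  have h1 := h.integral_prod_left
  have : Nontrivial (EuclideanSpace ℝ (Fin n)) := by
    subst hn
    infer_instance
  have h2 := (integrable_fun_norm_addHaar (volume : Measure (EuclideanSpace ℝ (Fin n)))
    (f := fun r => ∫ τ in Set.Ico 0 β, f r τ)).1 h1
  simp only [finrank_euclideanSpace, Fintype.card_fin, smul_eq_mul, hn,
    show k + 2 - 1 = k + 1 by omega,
    integral_Ico_eq_integral_Ioc] at h2
  simpa only [intervalIntegral.integral_of_le hβ.le] using h2

/-- Spatial decay estimate for a nonnegative, periodic, radial nonincreasing configuration with
finite gradient and kinetic terms: `‖x‖^{(D-3)/2} φ` is bounded outside any ball. -/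
theorem stmt14 (D : ℕ) (hD : 4 ≤ D) (n : ℕ) (hn : n = D - 1) (β : ℝ) (hβ : 0 < β)
    (φ : EuclideanSpace ℝ (Fin n) × ℝ → ℝ)
    (hφ : ContDiff ℝ 1 φ)
    (hpos : ∀ z : EuclideanSpace ℝ (Fin n) × ℝ, 0 ≤ φ z)
    (hper : ∀ x : EuclideanSpace ℝ (Fin n), ∀ τ : ℝ, φ (x, τ + β) = φ (x, τ))
    (hvan : VanishesAtSpatialInfinity φ)
    (hrad : ∃ g : ℝ → ℝ → ℝ, SpatiallyRadialNonincreasing φ g)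
    (hTint : IntegrableOn (fun z : EuclideanSpace ℝ (Fin n) × ℝ => ‖spatialGrad φ z.1 z.2‖ ^ 2)
      (Set.univ ×ˢ Set.Ico (0 : ℝ) β) volume)
    (hKint : IntegrableOn (fun z : EuclideanSpace ℝ (Fin n) × ℝ => (timeDeriv φ z.1 z.2) ^ 2)
      (Set.univ ×ˢ Set.Ico (0 : ℝ) β) volume) :
    ∀ R > (0 : ℝ), ∃ c : ℝ, 0 ≤ c ∧
      ∀ τ : ℝ, ∀ x : EuclideanSpace ℝ (Fin n), R ≤ ‖x‖ →
        ‖x‖ ^ (((D : ℝ) - 3) / 2) * φ (x, τ) ≤ c := by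
  intro R hR
  obtain ⟨g, hg, hanti⟩ := hrad
  obtain ⟨k, rfl⟩ : ∃ k, D = k + 3 := ⟨D - 3, by omega⟩
  have hnk : n = k + 2 := by omega
  have : Nontrivial (EuclideanSpace ℝ (Fin n)) := by
    subst hnk
    infer_instance
  obtain ⟨e, he⟩ := exists_norm_eq (EuclideanSpace ℝ (Fin n)) zero_le_one
  have hnorm : ∀ r : ℝ, 0 ≤ r → ‖r • e‖ = r := fun r hr => by
    rw [norm_smul, he, mul_one, Real.norm_of_nonneg hr]
  have hφd : Differentiable ℝ φ := hφ.differentiable one_ne_zero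
  have hφ' : Continuous (fderiv ℝ φ) := hφ.continuous_fderiv one_ne_zero
  have hφrad : ∀ x y : EuclideanSpace ℝ (Fin n), ‖x‖ = ‖y‖ → ∀ τ, φ (x, τ) = φ (y, τ) :=
    fun x y h τ => by rw [hg, hg, h]
  set G : ℝ → ℝ → ℝ := fun r τ => φ (r • e, τ) with hG
  set P : ℝ → ℝ → ℝ := fun r τ => fderiv ℝ φ (r • e, τ) (e, 0) with hPdef
  set Q : ℝ → ℝ → ℝ := fun r τ => fderiv ℝ φ (r • e, τ) (0, 1) with hQdef
  have hGφ : ∀ x τ, φ (x, τ) = G ‖x‖ τ := fun x τ =>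
    hφrad _ _ (hnorm _ (norm_nonneg x)).symm τ
  have hray : Continuous fun z : ℝ × ℝ => (z.1 • e, z.2) := by fun_prop
  have hP : Continuous P.uncurry := (hφ'.comp hray).clm_apply continuous_const
  have hQ : Continuous Q.uncurry := (hφ'.comp hray).clm_apply continuous_const
  have hGP : ∀ r τ, HasDerivAt (fun r => G r τ) (P r τ) r := fun r τ => by
    have h : HasDerivAt (fun r : ℝ => (r • e, τ)) (e, (0 : ℝ)) r := by
      simpa using ((hasDerivAt_id r).smul_const e).prodMk (hasDerivAt_const r τ)
    exact (hφd (r • e, τ)).hasFDerivAt.comp_hasDerivAt r h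
  have hGQ : ∀ r τ, HasDerivAt (fun τ => G r τ) (Q r τ) τ := fun r τ => by
    have h : HasDerivAt (fun τ : ℝ => (r • e, τ)) ((0 : EuclideanSpace ℝ (Fin n)), (1 : ℝ)) τ :=
      (hasDerivAt_const τ (r • e)).prodMk (hasDerivAt_id τ)
    exact (hφd (r • e, τ)).hasFDerivAt.comp_hasDerivAt τ h
  have hgrad : ∀ x τ v, inner ℝ (spatialGrad φ x τ) v = fderiv ℝ φ (x, τ) (v, 0) :=
    fun x τ v => by
      have h : HasFDerivAt (fun y => φ (y, τ))
          ((fderiv ℝ φ (x, τ)).comp (ContinuousLinearMap.inl ℝ _ ℝ)) x :=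
        (hφd (x, τ)).hasFDerivAt.comp x (hasFDerivAt_prodMk_left x τ)
      rw [spatialGrad, inner_gradient_left, h.fderiv]
      simp
  have hPle : ∀ x τ, P ‖x‖ τ ^ 2 ≤ ‖spatialGrad φ x τ‖ ^ 2 := fun x τ => by
    suffices ∃ v, ‖v‖ = 1 ∧ P ‖x‖ τ = inner ℝ (spatialGrad φ x τ) v by
      obtain ⟨v, hv, h⟩ := this
      rw [h, sq_le_sq, abs_norm]
      simpa [hv] using abs_real_inner_le_norm (spatialGrad φ x τ) v
    rcases eq_or_ne x 0 with rfl | hx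
    · exact ⟨e, he, by simp [hgrad, hPdef]⟩
    · have hx0 : 0 < ‖x‖ := norm_pos_iff.2 hx
      set v := ‖x‖⁻¹ • x with hv
      have hv1 : ‖v‖ = 1 := by rw [hv, norm_smul, norm_inv, norm_norm, inv_mul_cancel₀ hx0.ne']
      have hxv : ‖x‖ • v = x := smul_inv_smul₀ hx0.ne' x
      refine ⟨v, hv1, ?_⟩
      have h : HasDerivAt (fun r : ℝ => (r • v, τ)) (v, (0 : ℝ)) ‖x‖ := by
        simpa using ((hasDerivAt_id ‖x‖).smul_const v).prodMk (hasDerivAt_const ‖x‖ τ)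
      have h2 := (hφd (‖x‖ • v, τ)).hasFDerivAt.comp_hasDerivAt ‖x‖ h
      have h3 : (φ ∘ fun r : ℝ => (r • v, τ)) = fun r => G r τ := by
        funext r
        exact hφrad _ _ ((norm_smul r v).trans (by rw [hv1, norm_smul, he])) τ
      rw [h3, hxv] at h2
      rw [hgrad]
      exact (hGP ‖x‖ τ).unique h2
  have hQeq : ∀ x τ, timeDeriv φ x τ = Q ‖x‖ τ := fun x τ => by
    rw [timeDeriv, ← (hGQ ‖x‖ τ).deriv]
    simp only [hGφ x]
  have hPint := integrableOn_pow_mul_of_norm (f := fun r τ => P r τ ^ 2) hnk hβ (by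
    refine hTint.mono' ?_ (.of_forall fun z => ?_)
    · have : Continuous fun z : EuclideanSpace ℝ (Fin n) × ℝ => P ‖z.1‖ z.2 :=
        hP.comp (by fun_prop : Continuous fun z : EuclideanSpace ℝ (Fin n) × ℝ => (‖z.1‖, z.2))
      exact (this.pow 2).aestronglyMeasurable
    · rw [Real.norm_of_nonneg (sq_nonneg _)]
      exact hPle _ _)
  have hQint := integrableOn_pow_mul_of_norm (f := fun r τ => Q r τ ^ 2) hnk hβ (by
    simpa only [hQeq] using hKint)
  have hvan' : ∀ ε > 0, ∃ L, ∀ r ≥ L, ∀ τ, G r τ < ε := fun ε hε => by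
    obtain ⟨K, hK, hKε⟩ := hvan ε hε
    obtain ⟨M, hM⟩ := hK.isBounded.exists_norm_le
    refine ⟨max (M + 1) 0, fun r hr τ => ?_⟩
    refine (le_abs_self _).trans_lt (hKε (r • e) (fun hmem => ?_) τ)
    have h := hM _ hmem
    rw [hnorm r ((le_max_right _ _).trans hr)] at h
    linarith [(le_max_left (M + 1) 0).trans hr]
  have hanti' : ∀ τ, AntitoneOn (fun r => G r τ) (Set.Ici 0) := fun τ =>
    (hanti τ).congr fun r hr => by simp only [hG, hg, hnorm r hr]
  obtain ⟨c, hc0, hc⟩ := profile_decay hβ (by omega) hP hQ hGP hGQ hanti'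
    (fun r τ => hper (r • e) τ) hvan' hPint hQint hR
  refine ⟨c, hc0, fun τ x hx => ?_⟩
  rw [hGφ, show (((k + 3 : ℕ) : ℝ) - 3) / 2 = (k : ℝ) / 2 by push_cast; ring]
  exact hc τ ‖x‖ hx
end

section
/- Let D ≥ 4 be an integer, n = D−1, and β > 0. Let φ : ℝⁿ × ℝ → ℝ be continuously differentiable, nonnegative, β-periodic in time, and spatially radial and nonincreasing with radial profile g (so φ(x,τ) = g(‖x‖,τ) and r ↦ g(r,τ) is nonincreasing for every τ). Then for all real numbers 0 < r₀ < r₁, sup_{τ∈[0,β)} g(r₁,τ) ≤ inf_{τ∈[0,β)} g(r₀,τ) + (1/(ωₙ·(r₁ⁿ − r₀ⁿ))) · ∫_{τ∈[0,β)}∫_{r₀<‖x‖<r₁} |∂_τφ(x,τ)| dx dτ, where ωₙ is the Lebesgue measure of the unit ball in ℝⁿ. -/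
open MeasureTheory

/-- The open annulus `a < ‖x‖ < b` in `ℝⁿ`. -/
def annulus (n : ℕ) (a b : ℝ) : Set (EuclideanSpace ℝ (Fin n)) :=
  {x | a < ‖x‖ ∧ ‖x‖ < b}

theorem annulus_eq_sdiff (n : ℕ) (a b : ℝ) :
    annulus n a b = Metric.ball 0 b \ Metric.closedBall 0 a := by
  ext x
  simp [annulus, and_comm]

theorem measurableSet_annulus (n : ℕ) (a b : ℝ) : MeasurableSet (annulus n a b) := by
  rw [annulus_eq_sdiff]
  exact measurableSet_ball.diff measurableSet_closedBall

theorem annulus_subset_closedBall (n : ℕ) (a b : ℝ) :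
    annulus n a b ⊆ Metric.closedBall 0 b := by
  rw [annulus_eq_sdiff]
  exact Set.sdiff_subset.trans Metric.ball_subset_closedBall

theorem measure_annulus_lt_top (n : ℕ) (a b : ℝ) : volume (annulus n a b) < ⊤ :=
  (measure_mono (annulus_subset_closedBall n a b)).trans_lt measure_closedBall_lt_top

theorem volume_real_annulus {n : ℕ} {a b : ℝ} (ha : 0 ≤ a) (hab : a < b) :
    volume.real (annulus n a b) =
      (volume (Metric.ball (0 : EuclideanSpace ℝ (Fin n)) 1)).toReal * (b ^ n - a ^ n) := by
  rw [annulus_eq_sdiff, measureReal_sdiff (Metric.closedBall_subset_ball hab)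
    measurableSet_closedBall, Measure.addHaar_real_closedBall _ _ ha, measureReal_def,
    Measure.addHaar_ball_of_pos _ _ (ha.trans_lt hab), finrank_euclideanSpace_fin,
    ENNReal.toReal_mul, ENNReal.toReal_ofReal (pow_nonneg (ha.trans hab.le) n), measureReal_def]
  ring

theorem continuous_timeDeriv {n : ℕ} {φ : EuclideanSpace ℝ (Fin n) × ℝ → ℝ}
    (hφ : ContDiff ℝ 1 φ) :
    Continuous fun p : EuclideanSpace ℝ (Fin n) × ℝ => timeDeriv φ p.1 p.2 := by
  have h : (fun p : EuclideanSpace ℝ (Fin n) × ℝ => timeDeriv φ p.1 p.2) =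
      fun p => fderiv ℝ φ p (0, 1) := by
    ext ⟨x, τ⟩
    exact ((hφ.differentiable one_ne_zero (x, τ)).hasFDerivAt.comp_hasDerivAt τ
      ((hasDerivAt_const τ x).prodMk (hasDerivAt_id τ))).deriv
  rw [h]
  exact (hφ.continuous_fderiv one_ne_zero).clm_apply continuous_const

theorem integrable_abs_timeDeriv {n : ℕ} {φ : EuclideanSpace ℝ (Fin n) × ℝ → ℝ}
    (hφ : ContDiff ℝ 1 φ) (β a b : ℝ) :
    Integrable (Function.uncurry fun x τ => |timeDeriv φ x τ|)
      ((volume.restrict (annulus n a b)).prod (volume.restrict (Set.Ico 0 β))) := by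
  rw [Measure.prod_restrict]
  exact ((continuous_timeDeriv hφ).abs.continuousOn.integrableOn_compact
    ((isCompact_closedBall 0 b).prod isCompact_Icc)).mono_set
      (Set.prod_mono (annulus_subset_closedBall n a b) Set.Ico_subset_Icc_self)

/-- The oscillation of a `C¹` function on `[a, b)` is at most the integral of the absolute
value of its derivative over `[a, b)`. -/
theorem abs_sub_le_setIntegral_abs_deriv {f : ℝ → ℝ} {a b s t : ℝ} (hf : Differentiable ℝ f)
    (hf' : Continuous (deriv f)) (hs : s ∈ Set.Ico a b) (ht : t ∈ Set.Ico a b) :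
    |f t - f s| ≤ ∫ u in Set.Ico a b, |deriv f u| := by
  rw [← intervalIntegral.integral_eq_sub_of_hasDerivAt (fun u _ => (hf u).hasDerivAt)
    (hf'.intervalIntegrable s t)]
  refine (intervalIntegral.norm_integral_le_integral_norm_uIoc (f := deriv f)).trans ?_
  refine setIntegral_mono_set ((hf'.abs.integrableOn_Icc).mono_set Set.Ico_subset_Icc_self)
    (Filter.Eventually.of_forall fun u => abs_nonneg _) (LE.le.eventuallyLE ?_)
  exact fun u hu => ⟨(le_min hs.1 ht.1).trans hu.1.le, hu.2.trans_lt (max_lt hs.2 ht.2)⟩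

/-- Oscillation estimate over an annulus: the sup over the time circle of the radial profile at
radius `r₁` is bounded by its inf at radius `r₀` plus the averaged time derivative over the
annulus `r₀ < ‖x‖ < r₁`. -/
theorem stmt15 (D : ℕ) (hD : 4 ≤ D) (n : ℕ) (hn : n = D - 1) (β : ℝ) (hβ : 0 < β)
    (φ : EuclideanSpace ℝ (Fin n) × ℝ → ℝ)
    (hφ : ContDiff ℝ 1 φ)
    (hpos : ∀ z : EuclideanSpace ℝ (Fin n) × ℝ, 0 ≤ φ z)
    (hper : ∀ x : EuclideanSpace ℝ (Fin n), ∀ τ : ℝ, φ (x, τ + β) = φ (x, τ))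
    (g : ℝ → ℝ → ℝ) (hrad : SpatiallyRadialNonincreasing φ g)
    (r₀ r₁ : ℝ) (hr₀ : 0 < r₀) (hr₀₁ : r₀ < r₁) :
    (⨆ τ : Set.Ico (0 : ℝ) β, g r₁ τ) ≤
      (⨅ τ : Set.Ico (0 : ℝ) β, g r₀ τ) +
        (1 / ((volume (Metric.ball (0 : EuclideanSpace ℝ (Fin n)) 1)).toReal *
            (r₁ ^ n - r₀ ^ n))) *
          ∫ τ in Set.Ico (0 : ℝ) β,
            ∫ x in {x : EuclideanSpace ℝ (Fin n) | r₀ < ‖x‖ ∧ ‖x‖ < r₁}, |timeDeriv φ x τ| := by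
  subst hn
  have : Nonempty (Set.Ico (0 : ℝ) β) := ⟨⟨0, le_rfl, hβ⟩⟩
  have hvol : 0 < volume.real (annulus (D - 1) r₀ r₁) := by
    have : r₀ ^ (D - 1) < r₁ ^ (D - 1) := pow_lt_pow_left₀ hr₀₁ hr₀.le (by omega)
    rw [volume_real_annulus hr₀.le hr₀₁]
    exact mul_pos (ENNReal.toReal_pos (Metric.measure_ball_pos _ _ one_pos).ne'
      measure_ball_lt_top.ne) (sub_pos.2 this)
  refine ciSup_le fun τ₁ => ?_
  rw [← sub_le_iff_le_add]
  refine le_ciInf fun τ₀ => ?_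
  rw [sub_le_iff_le_add, ← sub_le_iff_le_add', ← volume_real_annulus hr₀.le hr₀₁,
    one_div_mul_eq_div, le_div_iff₀ hvol]
  have hcont := continuous_timeDeriv hφ
  have hint := integrable_abs_timeDeriv hφ β r₀ r₁
  change _ ≤ ∫ τ in Set.Ico (0 : ℝ) β, ∫ x in annulus (D - 1) r₀ r₁, |timeDeriv φ x τ|
  rw [← integral_integral_swap hint, mul_comm, ← smul_eq_mul, ← setIntegral_const]
  refine setIntegral_mono_on (integrableOn_const (measure_annulus_lt_top _ _ _).ne)
    hint.integral_prod_left (measurableSet_annulus _ _ _) fun x hx => ?_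
  have hosc : φ (x, τ₁) - φ (x, τ₀) ≤ ∫ τ in Set.Ico (0 : ℝ) β, |timeDeriv φ x τ| :=
    (le_abs_self _).trans <| abs_sub_le_setIntegral_abs_deriv
      (fun s => (hφ.comp (contDiff_prodMk_right x)).differentiable one_ne_zero s)
      (hcont.comp (Continuous.prodMk_right x)) τ₀.2 τ₁.2
  have h₁ : g r₁ τ₁ ≤ φ (x, τ₁) := by
    rw [hrad.1]
    exact hrad.2 τ₁ (norm_nonneg x) (hr₀.trans hr₀₁).le hx.2.le
  have h₀ : φ (x, τ₀) ≤ g r₀ τ₀ := by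
    rw [hrad.1]
    exact hrad.2 τ₀ hr₀.le (norm_nonneg x) hx.1.le
  linarith
end
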